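/- Let a, b ∈ ℕ, let U be a nonzero element of the subspace H_{−a} ⊕ H_{−a+1} ⊕ ⋯ ⊕ H_b of H(q), and let n_{−a}, n_{−a+1}, …, n_0 be positive integers. Then (η_{n_{−a}} ∘ η_{n_{−a+1}} ∘ ⋯ ∘ η_{n_0})(U) is a nonzero element of H_1 ⊕ H_2 ⊕ ⋯ ⊕ H_{a+b+1}. -/

import Mathlib

noncomputable section

/-- Generators of the `q`-deformed Heisenberg algebra. -/
inductive HGen : Type
  | A : HGen
  | B : HGen

/-- The defining relation `AB = q • BA + 1` of the `q`-deformed Heisenberg algebra. -/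
inductive HRel (q : ℂ) : FreeAlgebra ℂ HGen → FreeAlgebra ℂ HGen → Prop
  | rel : HRel q (FreeAlgebra.ι ℂ HGen.A * FreeAlgebra.ι ℂ HGen.B)
      (q • (FreeAlgebra.ι ℂ HGen.B * FreeAlgebra.ι ℂ HGen.A) + 1)

/-- The `q`-deformed Heisenberg algebra `H(q)`, presented by generators `A`, `B`
and the single relation `AB - q • BA = 1`. -/
abbrev HAlg (q : ℂ) := RingQuot (HRel q)

/-- The generator `A` of `H(q)`. -/
def genA (q : ℂ) : HAlg q := RingQuot.mkAlgHom ℂ (HRel q) (FreeAlgebra.ι ℂ HGen.A)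

/-- The generator `B` of `H(q)`. -/
def genB (q : ℂ) : HAlg q := RingQuot.mkAlgHom ℂ (HRel q) (FreeAlgebra.ι ℂ HGen.B)

/-- The element `C = AB - BA` of `H(q)`. -/
def genC (q : ℂ) : HAlg q := genA q * genB q - genB q * genA q

/-- The deformed commutator map `θ_n : γ ↦ Aγ - q^n γA` on `H(q)`, `n ∈ ℤ`. -/
def thetaZ (q : ℂ) (n : ℤ) (x : HAlg q) : HAlg q :=
  genA q * x - q ^ n • (x * genA q)

/-- The deformed commutator map `η_n : γ ↦ Bγ - q^n γB` on `H(q)`, `n ∈ ℤ`. -/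
def etaZ (q : ℂ) (n : ℤ) (x : HAlg q) : HAlg q :=
  genB q * x - q ^ n • (x * genB q)

/-- The graded component `H_i` of `H(q)`: for `i < 0` the span of `{C^k A^(-i) : k ∈ ℕ}`,
for `i > 0` the span of `{C^k B^i : k ∈ ℕ}`, and for `i = 0` the span of `{C^k : k ∈ ℕ}`. -/
def Hgr (q : ℂ) (i : ℤ) : Submodule ℂ (HAlg q) :=
  Submodule.span ℂ {x | ∃ k : ℕ,
    x = genC q ^ k * (if i < 0 then genA q ^ (-i).toNat else genB q ^ i.toNat)}

/-- The collection `Φ_ℤ = {θ_n : n ∈ ℤ} ∪ {η_n : n ∈ ℤ}` of deformed commutator maps. -/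
def PhiZ (q : ℂ) : Set (HAlg q → HAlg q) :=
  {f | ∃ n : ℤ, f = thetaZ q n ∨ f = etaZ q n}

/-- `applyChain f m = f m ∘ ⋯ ∘ f 1 ∘ f 0` (the map `f 0` is applied first). -/
def applyChain {E : Type*} (f : ℕ → E → E) : ℕ → E → E
  | 0 => f 0
  | m + 1 => f (m + 1) ∘ applyChain f m

/-- The monomial `A^(-i)` (for `i < 0`) or `B^i` (for `i ≥ 0`) of degree `i`. -/
def gradedGen (q : ℂ) (i : ℤ) : HAlg q :=
  if i < 0 then genA q ^ (-i).toNat else genB q ^ i.toNat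

lemma gradedGen_natCast (q : ℂ) (l : ℕ) : gradedGen q l = genB q ^ l := by
  simp [gradedGen]

lemma gradedGen_neg_natCast (q : ℂ) (l : ℕ) : gradedGen q (-l) = genA q ^ l := by
  rcases l.eq_zero_or_pos with rfl | hl
  · simp [gradedGen]
  · simp [gradedGen, hl]

lemma genA_mul_genB (q : ℂ) : genA q * genB q = q • (genB q * genA q) + 1 := by
  simpa [genA, genB] using RingQuot.mkAlgHom_rel ℂ (HRel.rel (q := q))

lemma genC_eq (q : ℂ) : genC q = (q - 1) • (genB q * genA q) + 1 := by
  rw [genC, genA_mul_genB]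
  module

lemma genB_mul_genA {q : ℂ} (hq : q ≠ 1) :
    genB q * genA q = (q - 1)⁻¹ • (genC q - 1) := by
  rw [genC_eq, add_sub_cancel_right, inv_smul_smul₀ (sub_ne_zero.2 hq)]

lemma genA_mul_genC (q : ℂ) : genA q * genC q = q • (genC q * genA q) := by
  have h : genA q * (genB q * genA q) = q • (genB q * genA q * genA q) + genA q := by
    rw [← mul_assoc, genA_mul_genB, add_mul, one_mul, smul_mul_assoc]
  rw [genC_eq, mul_add, add_mul, mul_smul_comm, h, smul_mul_assoc, mul_one, one_mul]
  module

lemma genB_mul_genC {q : ℂ} (hq0 : q ≠ 0) : genB q * genC q = q⁻¹ • (genC q * genB q) := by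
  have h : genB q * genA q * genB q = q • (genB q * (genB q * genA q)) + genB q := by
    rw [mul_assoc, genA_mul_genB, mul_add, mul_one, mul_smul_comm]
  rw [eq_inv_smul_iff₀ hq0, genC_eq, mul_add, add_mul, mul_smul_comm, smul_mul_assoc, h,
    mul_one, one_mul]
  module

lemma genA_pow_mul_genC (q : ℂ) (l : ℕ) :
    genA q ^ l * genC q = q ^ l • (genC q * genA q ^ l) := by
  induction l with
  | zero => simp
  | succ l ih =>
    rw [pow_succ, mul_assoc, genA_mul_genC, mul_smul_comm, ← mul_assoc, ih, smul_mul_assoc,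
      smul_smul, mul_assoc, pow_succ' q]

open Polynomial in
lemma genB_mul_aeval_genC {q : ℂ} (hq0 : q ≠ 0) (p : ℂ[X]) :
    genB q * aeval (genC q) p = aeval (genC q) (p.comp (C q⁻¹ * X)) * genB q := by
  induction p using Polynomial.induction_on' with
  | add p r hp hr => simp only [map_add, mul_add, add_comp, add_mul, hp, hr]
  | monomial k c =>
    have h : genB q * genC q ^ k = (q⁻¹) ^ k • (genC q ^ k * genB q) := by
      induction k with
      | zero => simp
      | succ k ih =>
        rw [pow_succ (genC q), ← mul_assoc, ih, smul_mul_assoc, mul_assoc, genB_mul_genC hq0,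
          mul_smul_comm, smul_smul, mul_assoc, pow_succ (q⁻¹)]
    rw [← C_mul_X_pow_eq_monomial]
    simp only [map_mul, aeval_C, aeval_X_pow, mul_comp, C_comp, X_pow_comp, mul_pow, ← C_pow,
      ← Algebra.smul_def, mul_smul_comm, smul_mul_assoc, h]
    exact smul_comm _ _ _

open Polynomial in
/-- Multiplying a homogeneous monomial by `B` on either side yields a polynomial in `C` times the
next monomial, and both polynomials have the same nonzero constant term. -/
lemma exists_genB_mul_gradedGen {q : ℂ} (hq : q ≠ 1) (i : ℤ) :
    ∃ u v : ℂ[X], u.coeff 0 = v.coeff 0 ∧ v.coeff 0 ≠ 0 ∧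
      genB q * gradedGen q i = aeval (genC q) u * gradedGen q (i + 1) ∧
      gradedGen q i * genB q = aeval (genC q) v * gradedGen q (i + 1) := by
  have hq' : q - 1 ≠ 0 := sub_ne_zero.2 hq
  rcases lt_or_ge i 0 with hi | hi
  · obtain ⟨l, rfl⟩ : ∃ l : ℕ, i = -((l + 1 : ℕ) : ℤ) := ⟨(-i - 1).toNat, by omega⟩
    have hl : -((l + 1 : ℕ) : ℤ) + 1 = -(l : ℤ) := by push_cast; ring
    refine ⟨C (q - 1)⁻¹ * (X - 1), C (q - 1)⁻¹ * (C (q ^ (l + 1)) * X - 1), by simp, by simp [hq'],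
      ?_, ?_⟩
    · rw [hl, gradedGen_neg_natCast, gradedGen_neg_natCast, pow_succ', ← mul_assoc,
        genB_mul_genA hq]
      simp [Algebra.smul_def]
    · have h : genA q * genB q = (q - 1)⁻¹ • (q • genC q - 1) := by
        rw [genA_mul_genB, genB_mul_genA hq, eq_inv_smul_iff₀ hq', smul_add, smul_comm (q - 1) q,
          smul_inv_smul₀ hq']
        module
      rw [hl, gradedGen_neg_natCast, gradedGen_neg_natCast, pow_succ, mul_assoc, h,
        mul_smul_comm, mul_sub, mul_smul_comm, genA_pow_mul_genC, smul_smul, ← pow_succ']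
      simp only [map_mul, aeval_C, map_sub, aeval_X, map_one, ← Algebra.smul_def, smul_mul_assoc,
        sub_mul, one_mul, mul_one]
  · obtain ⟨l, rfl⟩ := Int.eq_ofNat_of_zero_le hi
    refine ⟨1, 1, rfl, by simp, ?_, ?_⟩
    · rw [← Nat.cast_succ, gradedGen_natCast, gradedGen_natCast, map_one, one_mul, pow_succ']
    · rw [← Nat.cast_succ, gradedGen_natCast, gradedGen_natCast, map_one, one_mul, pow_succ]

open Polynomial in
lemma eq_zero_of_comp_mul_eq {q : ℂ} (hq0 : q ≠ 0) (hq1 : ∀ m : ℕ, 0 < m → q ^ m ≠ 1)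
    {n : ℤ} (hn : 0 < n) {u v p : ℂ[X]} (huv : u.coeff 0 = v.coeff 0) (hv : v.coeff 0 ≠ 0)
    (h : p.comp (C q⁻¹ * X) * u = C (q ^ n) * (p * v)) : p = 0 := by
  by_contra hp
  obtain ⟨r, hr, hdvd⟩ := p.exists_eq_pow_rootMultiplicity_mul_and_not_dvd hp 0
  set k := p.rootMultiplicity 0
  rw [C_0, sub_zero] at hr hdvd
  have hr0 : r.coeff 0 ≠ 0 := fun h0 => hdvd (X_dvd_iff.2 h0)
  have hk : X ^ k * (C (q⁻¹ ^ k) * (r.comp (C q⁻¹ * X) * u)) = X ^ k * (C (q ^ n) * (r * v)) := by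
    rw [hr, mul_comp, X_pow_comp, mul_pow, ← C_pow] at h
    linear_combination h
  have h0 := congrArg (eval 0) (mul_left_cancel₀ (pow_ne_zero k X_ne_zero) hk)
  simp only [eval_mul, eval_comp, eval_C, eval_X, mul_zero, ← coeff_zero_eq_eval_zero, huv] at h0
  have h1 : q⁻¹ ^ k = q ^ n := mul_right_cancel₀ (mul_ne_zero hr0 hv) h0
  obtain ⟨m, rfl⟩ := Int.eq_ofNat_of_zero_le hn.le
  refine hq1 (m + k) (by omega) ?_
  rw [zpow_natCast] at h1
  rw [pow_add, ← h1, ← mul_pow, inv_mul_cancel₀ hq0, one_pow]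

open Polynomial in
lemma exists_etaZ_aeval_mul {q : ℂ} (hq0 : q ≠ 0) (hq1 : ∀ m : ℕ, 0 < m → q ^ m ≠ 1)
    {n : ℤ} (hn : 0 < n) (i : ℤ) (p : ℂ[X]) :
    ∃ r : ℂ[X], etaZ q n (aeval (genC q) p * gradedGen q i) =
      aeval (genC q) r * gradedGen q (i + 1) ∧ (r = 0 → p = 0) := by
  have hq : q ≠ 1 := by simpa using hq1 1 one_pos
  obtain ⟨u, v, huv, hv, hu, hv'⟩ := exists_genB_mul_gradedGen hq i
  refine ⟨p.comp (C q⁻¹ * X) * u - C (q ^ n) * (p * v), ?_, fun h =>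
    eq_zero_of_comp_mul_eq hq0 hq1 hn huv hv (sub_eq_zero.1 h)⟩
  rw [etaZ, ← mul_assoc, genB_mul_aeval_genC hq0, mul_assoc, hu, mul_assoc (aeval (genC q) p), hv']
  simp only [map_sub, map_mul, aeval_C, sub_mul, ← Algebra.smul_def, smul_mul_assoc, mul_assoc]

/-- The operator `f ↦ (m ↦ f (m - 1))` on functions `ℤ → ℂ`. -/
def shiftOp : Module.End ℂ (ℤ → ℂ) where
  toFun f m := f (m - 1)
  map_add' _ _ := rfl
  map_smul' _ _ := rfl

/-- The `q`-difference operator `f ↦ (m ↦ [m + 1] f (m + 1))` on functions `ℤ → ℂ`, where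
`[m] = (q ^ m - 1) / (q - 1)`. -/
def qDiffOp (q : ℂ) : Module.End ℂ (ℤ → ℂ) where
  toFun f m := (q ^ (m + 1) - 1) / (q - 1) * f (m + 1)
  map_add' f g := by ext; simp [mul_add]
  map_smul' c f := by ext; simp [mul_left_comm]

lemma qDiffOp_mul_shiftOp {q : ℂ} (hq0 : q ≠ 0) (hq : q ≠ 1) :
    qDiffOp q * shiftOp = q • (shiftOp * qDiffOp q) + 1 := by
  have hq' : q - 1 ≠ 0 := sub_ne_zero.2 hq
  ext f m
  simp only [qDiffOp, shiftOp, Module.End.mul_apply, LinearMap.coe_mk, AddHom.coe_mk,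
    LinearMap.add_apply, LinearMap.smul_apply, Module.End.one_apply, Pi.add_apply, Pi.smul_apply,
    smul_eq_mul, add_sub_cancel_right, sub_add_cancel]
  rw [zpow_add_one₀ hq0]
  field_simp
  ring

/-- The representation of `H(q)` on functions `ℤ → ℂ` by shift and `q`-difference operators. -/
def functionRep {q : ℂ} (hq0 : q ≠ 0) (hq : q ≠ 1) : HAlg q →ₐ[ℂ] Module.End ℂ (ℤ → ℂ) :=
  RingQuot.liftAlgHom ℂ ⟨FreeAlgebra.lift ℂ fun g => HGen.casesOn g (qDiffOp q) shiftOp, by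
    rintro _ _ ⟨⟩
    simpa using qDiffOp_mul_shiftOp hq0 hq⟩

section functionRep

variable {q : ℂ} (hq0 : q ≠ 0) (hq : q ≠ 1)

lemma functionRep_genA : functionRep hq0 hq (genA q) = qDiffOp q := by
  simp [functionRep, genA]

lemma functionRep_genB : functionRep hq0 hq (genB q) = shiftOp := by
  simp [functionRep, genB]

lemma functionRep_genC_apply (f : ℤ → ℂ) (m : ℤ) :
    functionRep hq0 hq (genC q) f m = q ^ m * f m := by
  have hq' : q - 1 ≠ 0 := sub_ne_zero.2 hq
  rw [genC_eq, map_add, map_smul, map_mul, map_one, functionRep_genA, functionRep_genB]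
  simp only [qDiffOp, shiftOp, Module.End.mul_apply, LinearMap.coe_mk, AddHom.coe_mk,
    LinearMap.add_apply, LinearMap.smul_apply, Module.End.one_apply, Pi.add_apply, Pi.smul_apply,
    smul_eq_mul, sub_add_cancel]
  field_simp
  ring

open Polynomial in
lemma functionRep_aeval_genC_apply (p : ℂ[X]) (f : ℤ → ℂ) (m : ℤ) :
    functionRep hq0 hq (aeval (genC q) p) f m = p.eval (q ^ m) * f m := by
  induction p using Polynomial.induction_on' with
  | add p r hp hr => simp [hp, hr, add_mul]
  | monomial k c =>
    have h : functionRep hq0 hq (genC q ^ k) f m = (q ^ m) ^ k * f m := by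
      induction k with
      | zero => simp
      | succ k ih =>
        rw [pow_succ', map_mul, Module.End.mul_apply, functionRep_genC_apply, ih, pow_succ',
          mul_assoc]
    rw [aeval_monomial, ← Algebra.smul_def, map_smul, LinearMap.smul_apply, Pi.smul_apply, h,
      eval_monomial, smul_eq_mul, mul_assoc]

lemma exists_functionRep_gradedGen_apply (hq1 : ∀ m : ℕ, 0 < m → q ^ m ≠ 1) (i : ℤ) :
    ∃ w : ℤ → ℂ, (∀ m : ℕ, w m ≠ 0) ∧
      ∀ f m, functionRep hq0 hq (gradedGen q i) f m = w m * f (m - i) := by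
  obtain ⟨l, rfl | rfl⟩ := i.eq_nat_or_neg
  · refine ⟨1, fun m => one_ne_zero, fun f m => ?_⟩
    rw [gradedGen_natCast, Pi.one_apply, one_mul]
    induction l generalizing m with
    | zero => simp
    | succ l ih =>
      rw [pow_succ', map_mul, Module.End.mul_apply, functionRep_genB]
      change functionRep hq0 hq (genB q ^ l) f (m - 1) = _
      rw [ih]
      congr 1
      push_cast
      ring
  · simp only [gradedGen_neg_natCast]
    induction l with
    | zero => exact ⟨1, fun m => one_ne_zero, fun f m => by simp⟩
    | succ l ih =>
      obtain ⟨w, hw, hf⟩ := ih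
      refine ⟨fun m => (q ^ (m + 1) - 1) / (q - 1) * w (m + 1), fun m => ?_, fun f m => ?_⟩
      · refine mul_ne_zero (div_ne_zero (sub_ne_zero.2 ?_) (sub_ne_zero.2 hq)) ?_
        · exact_mod_cast hq1 (m + 1) m.succ_pos
        · exact_mod_cast hw (m + 1)
      · rw [pow_succ', map_mul, Module.End.mul_apply, functionRep_genA]
        change (q ^ (m + 1) - 1) / (q - 1) * functionRep hq0 hq (genA q ^ l) f (m + 1) = _
        rw [hf, mul_assoc]
        congr 3
        push_cast
        ring

end functionRep

lemma zpow_natCast_injective {q : ℂ} (hq0 : q ≠ 0) (hq1 : ∀ m : ℕ, 0 < m → q ^ m ≠ 1) :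
    Function.Injective fun m : ℕ => q ^ (m : ℤ) := by
  refine Function.Injective.of_lt_imp_ne fun a b hab h => hq1 (b - a) (by omega) ?_
  simp only [zpow_natCast] at h
  rw [pow_sub₀ q hq0 hab.le, ← h, mul_inv_cancel₀ (pow_ne_zero a hq0)]

open Polynomial in
lemma eq_zero_of_sum_aeval_mul_gradedGen_eq_zero {q : ℂ} (hq0 : q ≠ 0)
    (hq1 : ∀ m : ℕ, 0 < m → q ^ m ≠ 1) {s : Finset ℤ} {p : ℤ → ℂ[X]}
    (h : ∑ i ∈ s, aeval (genC q) (p i) * gradedGen q i = 0) {i : ℤ} (hi : i ∈ s) : p i = 0 := by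
  have hq : q ≠ 1 := by simpa using hq1 1 one_pos
  choose w hw hf using exists_functionRep_gradedGen_apply hq0 hq hq1
  refine eq_zero_of_infinite_isRoot _ ((Set.infinite_range_of_injective
    (zpow_natCast_injective hq0 hq1)).mono ?_)
  rintro _ ⟨m, rfl⟩
  have hm := congrFun (congrArg (fun x => functionRep hq0 hq x (Pi.single (m - i) 1)) h) m
  simp only [map_sum, map_mul, map_zero, LinearMap.sum_apply, Finset.sum_apply,
    Module.End.mul_apply, functionRep_aeval_genC_apply, hf, LinearMap.zero_apply,
    Pi.zero_apply] at hm
  rw [Finset.sum_eq_single_of_mem i hi fun j _ hj => by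
    rw [Pi.single_eq_of_ne (by omega), mul_zero, mul_zero]] at hm
  simpa [hw] using hm

open Polynomial in
lemma mem_Hgr_iff {q : ℂ} {i : ℤ} {x : HAlg q} :
    x ∈ Hgr q i ↔ ∃ p : ℂ[X], x = aeval (genC q) p * gradedGen q i := by
  constructor
  · intro hx
    induction hx using Submodule.span_induction with
    | mem x hx =>
      obtain ⟨k, rfl⟩ := hx
      exact ⟨X ^ k, by simp [gradedGen]⟩
    | zero => exact ⟨0, by simp⟩
    | add x y _ _ hx hy =>
      obtain ⟨p, rfl⟩ := hx
      obtain ⟨r, rfl⟩ := hy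
      exact ⟨p + r, by simp [add_mul]⟩
    | smul c x _ hx =>
      obtain ⟨p, rfl⟩ := hx
      exact ⟨c • p, by simp⟩
  · rintro ⟨p, rfl⟩
    rw [aeval_eq_sum_range, Finset.sum_mul]
    refine Submodule.sum_mem _ fun k _ => ?_
    rw [smul_mul_assoc]
    exact Submodule.smul_mem _ _ (Submodule.subset_span ⟨k, rfl⟩)

open Polynomial in
lemma mem_iSup_Hgr_iff {q : ℂ} {a b : ℤ} {x : HAlg q} :
    x ∈ ⨆ i ∈ Set.Icc a b, Hgr q i ↔
      ∃ p : ℤ → ℂ[X], x = ∑ i ∈ Finset.Icc a b, aeval (genC q) (p i) * gradedGen q i := by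
  simp only [Set.mem_Icc, ← Finset.mem_Icc]
  rw [Submodule.mem_iSup_finset_iff_exists_sum]
  constructor
  · rintro ⟨y, rfl⟩
    choose p hp using fun i => mem_Hgr_iff.1 (y i).2
    exact ⟨p, Finset.sum_congr rfl fun i _ => hp i⟩
  · rintro ⟨p, rfl⟩
    exact ⟨fun i => ⟨_, mem_Hgr_iff.2 ⟨p i, rfl⟩⟩, rfl⟩

lemma etaZ_sum {ι : Type*} (q : ℂ) (n : ℤ) (s : Finset ι) (f : ι → HAlg q) :
    etaZ q n (∑ i ∈ s, f i) = ∑ i ∈ s, etaZ q n (f i) := by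
  simp only [etaZ, Finset.mul_sum, Finset.sum_mul, Finset.smul_sum, Finset.sum_sub_distrib]

lemma etaZ_ne_zero_and_mem {q : ℂ} (hq0 : q ≠ 0) (hq1 : ∀ m : ℕ, 0 < m → q ^ m ≠ 1)
    {n : ℤ} (hn : 0 < n) {a b : ℤ} {x : HAlg q} (hx : x ≠ 0)
    (hmem : x ∈ ⨆ i ∈ Set.Icc a b, Hgr q i) :
    etaZ q n x ≠ 0 ∧ etaZ q n x ∈ ⨆ i ∈ Set.Icc (a + 1) (b + 1), Hgr q i := by
  obtain ⟨p, rfl⟩ := mem_iSup_Hgr_iff.1 hmem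
  choose r hr hr0 using fun i => exists_etaZ_aeval_mul hq0 hq1 hn i (p i)
  have h : etaZ q n (∑ i ∈ Finset.Icc a b, Polynomial.aeval (genC q) (p i) * gradedGen q i) =
      ∑ i ∈ Finset.Icc (a + 1) (b + 1),
        Polynomial.aeval (genC q) (r (i - 1)) * gradedGen q i := by
    rw [etaZ_sum, ← Finset.image_add_right_Icc,
      Finset.sum_image fun _ _ _ _ => add_right_cancel]
    simp only [add_sub_cancel_right, hr]
  refine ⟨fun h0 => hx (Finset.sum_eq_zero fun i hi => ?_), mem_iSup_Hgr_iff.2 ⟨_, h⟩⟩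
  have hi' : i + 1 ∈ Finset.Icc (a + 1) (b + 1) := by
    simpa using hi
  have := eq_zero_of_sum_aeval_mul_gradedGen_eq_zero hq0 hq1 (h.symm.trans h0) hi'
  rw [add_sub_cancel_right] at this
  rw [hr0 i this, map_zero, zero_mul]

lemma applyChain_etaZ_ne_zero_and_mem {q : ℂ} (hq0 : q ≠ 0) (hq1 : ∀ m : ℕ, 0 < m → q ^ m ≠ 1)
    {a b : ℤ} {x : HAlg q} (hx : x ≠ 0) (hmem : x ∈ ⨆ i ∈ Set.Icc a b, Hgr q i)
    {n : ℕ → ℤ} (m : ℕ) (hn : ∀ j ≤ m, 0 < n j) :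
    applyChain (fun j => etaZ q (n j)) m x ≠ 0 ∧
      applyChain (fun j => etaZ q (n j)) m x ∈
        ⨆ i ∈ Set.Icc (a + (m + 1)) (b + (m + 1)), Hgr q i := by
  induction m with
  | zero => simpa [applyChain] using etaZ_ne_zero_and_mem hq0 hq1 (hn 0 le_rfl) hx hmem
  | succ m ih =>
    obtain ⟨h0, h1⟩ := ih fun j hj => hn j (by omega)
    simpa only [applyChain, Function.comp_apply, Nat.cast_succ, add_assoc] using
      etaZ_ne_zero_and_mem hq0 hq1 (hn (m + 1) le_rfl) h0 h1

/-- Let `a, b ∈ ℕ`, let `U ≠ 0` lie in `H_{-a} ⊕ ⋯ ⊕ H_b`, and let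
`n_0, n_1, …, n_a` be positive integers (with `n_j` playing the role of `n_{-j}`).  Then
`(η_{n_a} ∘ ⋯ ∘ η_{n_1} ∘ η_{n_0})(U)` is a nonzero element of `H_1 ⊕ H_2 ⊕ ⋯ ⊕ H_{a+b+1}`. -/
theorem statement_5 (q : ℂ) (hq0 : q ≠ 0) (hq1 : ∀ m : ℕ, 0 < m → q ^ m ≠ 1)
    (a b : ℕ) (U : HAlg q) (hU : U ≠ 0)
    (hmem : U ∈ ⨆ i ∈ Set.Icc (-(a : ℤ)) (b : ℤ), Hgr q i)
    (n : ℕ → ℤ) (hn : ∀ j : ℕ, j ≤ a → 0 < n j) :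
    applyChain (fun j => etaZ q (n j)) a U ≠ 0 ∧
    applyChain (fun j => etaZ q (n j)) a U ∈
      ⨆ i ∈ Set.Icc (1 : ℤ) ((a : ℤ) + (b : ℤ) + 1), Hgr q i := by
  have h := applyChain_etaZ_ne_zero_and_mem hq0 hq1 hU hmem a hn
  rwa [neg_add_cancel_left, add_left_comm, ← add_assoc] at h
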